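/- Let C ⊂ [0,1] be the middle-third Cantor set and let μ be the Hausdorff measure of dimension log 2/log 3 restricted to C (a finite nonzero measure). Then μ-almost every x ∈ C is well approximable: for every ε > 0 there exist m ∈ ℤ and a positive integer k with |k·x − m| < ε/k. -/

import Mathlib

open MeasureTheory

/-- A real number `x` is well approximable: for every `ε > 0` there are `m ∈ ℤ` and a
positive integer `k` with `|k·x − m| < ε/k`. -/
def IsWA (x : ℝ) : Prop :=
  ∀ ε : ℝ, 0 < ε → ∃ (m : ℤ) (k : ℕ), 0 < k ∧ |(k : ℝ) * x - (m : ℝ)| < ε / (k : ℝ)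

/-- The middle-third Cantor set: reals in `[0,1]` admitting a base-3 expansion using only
the digits 0 and 2. -/
def middleThirdCantorSet : Set ℝ :=
  {x | x ∈ Set.Icc (0 : ℝ) 1 ∧
    ∃ a : ℕ → ℕ, (∀ n, a n = 0 ∨ a n = 2) ∧ x = ∑' n : ℕ, (a n : ℝ) / 3 ^ (n + 1)}

namespace CantorWellApproximable

open Filter Topology Matrix
open scoped MatrixGroups

/-! ### Unimodular lattices in the plane -/

/-- The image of the integer vector `v` under `g`; these are the points of the lattice `g ℤ²`. -/
def latticeVec (g : SL(2, ℝ)) (v : Fin 2 → ℤ) : Fin 2 → ℝ :=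
  g.1 *ᵥ fun i => (v i : ℝ)

lemma latticeVec_apply (g : SL(2, ℝ)) (v : Fin 2 → ℤ) (i : Fin 2) :
    latticeVec g v i = g i 0 * v 0 + g i 1 * v 1 := by
  simp [latticeVec, Matrix.mulVec, dotProduct, Fin.sum_univ_two]

lemma latticeVec_mul (g : SL(2, ℝ)) (γ : SL(2, ℤ)) (v : Fin 2 → ℤ) :
    latticeVec (g * (γ : SL(2, ℝ))) v = latticeVec g (γ.1 *ᵥ v) := by
  ext i
  simp [latticeVec, Matrix.mulVec, dotProduct, Fin.sum_univ_two, Matrix.mul_apply]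
  ring

lemma mulVec_ne_zero (γ : SL(2, ℤ)) {v : Fin 2 → ℤ} (hv : v ≠ 0) : γ.1 *ᵥ v ≠ 0 := by
  intro h
  apply hv
  have : (γ⁻¹).1 *ᵥ (γ.1 *ᵥ v) = v := by
    rw [Matrix.mulVec_mulVec, ← Matrix.SpecialLinearGroup.coe_mul, inv_mul_cancel]
    simp
  rw [← this, h, Matrix.mulVec_zero]

lemma continuous_entry (i j : Fin 2) : Continuous fun g : SL(2, ℝ) => g i j :=
  (continuous_apply_apply i j).comp continuous_subtype_val

lemma continuous_latticeVec (v : Fin 2 → ℤ) (i : Fin 2) :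
    Continuous fun g : SL(2, ℝ) => latticeVec g v i := by
  simp only [latticeVec_apply]
  exact ((continuous_entry i 0).mul continuous_const).add
    ((continuous_entry i 1).mul continuous_const)

lemma det_eq_one (g : SL(2, ℝ)) : g 0 0 * g 1 1 - g 0 1 * g 1 0 = 1 := by
  have := g.det_coe
  rwa [Matrix.det_fin_two] at this

instance : FirstCountableTopology SL(2, ℝ) :=
  have : FirstCountableTopology (Matrix (Fin 2) (Fin 2) ℝ) :=
    inferInstanceAs (FirstCountableTopology (Fin 2 → Fin 2 → ℝ))
  Matrix.SpecialLinearGroup.isClosedEmbedding_val.isEmbedding.firstCountableTopology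

lemma mul_entry (g h : SL(2, ℝ)) (i j : Fin 2) :
    (g * h) i j = g i 0 * h 0 j + g i 1 * h 1 j := by
  rw [Matrix.SpecialLinearGroup.coe_mul, Matrix.mul_apply, Fin.sum_univ_two]

lemma map_entry (γ : SL(2, ℤ)) (i j : Fin 2) : (γ : SL(2, ℝ)) i j = (γ i j : ℝ) := rfl

/-- The lower triangular unipotent matrix with entry `t`. -/
def lower (t : ℝ) : SL(2, ℝ) := ⟨!![1, 0; t, 1], by simp⟩

lemma lower_add (s t : ℝ) : lower (s + t) = lower s * lower t := by
  ext i j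
  rw [mul_entry]
  fin_cases i <;> fin_cases j <;> simp [lower]

lemma lower_zero : lower 0 = 1 := by
  ext i j
  fin_cases i <;> fin_cases j <;> simp [lower]

lemma continuous_lower : Continuous lower := by
  refine Continuous.subtype_mk (continuous_matrix fun i j => ?_) _
  fin_cases i <;> fin_cases j <;> simp <;> fun_prop

lemma latticeVec_lower_zero (t : ℝ) (g : SL(2, ℝ)) (v : Fin 2 → ℤ) :
    latticeVec (lower t * g) v 0 = latticeVec g v 0 := by
  simp only [latticeVec_apply, mul_entry]
  simp [lower]

lemma latticeVec_lower_one (t : ℝ) (g : SL(2, ℝ)) (v : Fin 2 → ℤ) :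
    latticeVec (lower t * g) v 1 = latticeVec g v 1 + t * latticeVec g v 0 := by
  simp only [latticeVec_apply, mul_entry]
  simp [lower]
  ring

/-- The product of the coordinates is at least `ε` in absolute value on the nonzero vectors of
the lattice `g ℤ²`. -/
def Avoids (ε : ℝ) (g : SL(2, ℝ)) : Prop :=
  ∀ v : Fin 2 → ℤ, v ≠ 0 → ε ≤ |latticeVec g v 0 * latticeVec g v 1|

lemma Avoids.mul_right {ε : ℝ} {g : SL(2, ℝ)} (h : Avoids ε g) (γ : SL(2, ℤ)) :
    Avoids ε (g * (γ : SL(2, ℝ))) := fun v hv => by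
  rw [latticeVec_mul]
  exact h _ (mulVec_ne_zero γ hv)

lemma isClosed_setOf_avoids (ε : ℝ) : IsClosed {g | Avoids ε g} := by
  simp only [Avoids, Set.ofPred_forall]
  exact isClosed_iInter fun v => isClosed_iInter fun _ => isClosed_le continuous_const
    ((continuous_latticeVec v 0).mul (continuous_latticeVec v 1)).abs

lemma Avoids.entry_ne_zero {ε : ℝ} (hε : 0 < ε) {g : SL(2, ℝ)} (h : Avoids ε g) :
    g 0 0 ≠ 0 := by
  intro h0
  have := h ![1, 0] (by simp)
  simp [latticeVec_apply, h0] at this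
  linarith

lemma isCompact_entries_le (R : ℝ) : IsCompact {g : SL(2, ℝ) | ∀ i j, |g i j| ≤ R} := by
  have h : IsCompact (Set.univ.pi fun _ : Fin 2 => Set.univ.pi fun _ : Fin 2 =>
      Set.Icc (-R) R) :=
    isCompact_univ_pi fun _ => isCompact_univ_pi fun _ => isCompact_Icc
  have h' := Matrix.SpecialLinearGroup.isClosedEmbedding_val.isCompact_preimage
    (K := (Set.univ.pi fun _ : Fin 2 => Set.univ.pi fun _ : Fin 2 => Set.Icc (-R) R :
      Set (Fin 2 → Fin 2 → ℝ))) h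
  have heq : {g : SL(2, ℝ) | ∀ i j, |g i j| ≤ R} = (fun g : SL(2, ℝ) => g.1) ⁻¹'
      (Set.univ.pi fun _ : Fin 2 => Set.univ.pi fun _ : Fin 2 => Set.Icc (-R) R :
        Set (Fin 2 → Fin 2 → ℝ)) :=
    Set.ext fun g => ⟨fun h i _ j _ => abs_le.1 (h i j),
      fun h i j => abs_le.2 (h i trivial j trivial)⟩
  rw [heq]
  exact h'

/-- Norm bounds for an almost shortest vector `(a, c)` of a unimodular lattice and a second basis
vector `(b, d)` whose projection to the first one is short. -/
lemma reduced_basis_bound {a b c d q δ : ℝ} (hδ : 0 < δ) (hq : δ ≤ q)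
    (h₁ : q ≤ a ^ 2 + c ^ 2) (h₂ : a ^ 2 + c ^ 2 < 1.1 * q) (h₃ : q ≤ b ^ 2 + d ^ 2)
    (hdet : a * d - b * c = 1) (hs : |a * b + c * d| ≤ (a ^ 2 + c ^ 2) / 2) :
    a ^ 2 + c ^ 2 ≤ 2 + 1 / δ ∧ b ^ 2 + d ^ 2 ≤ 2 + 1 / δ := by
  have hlag : (a ^ 2 + c ^ 2) * (b ^ 2 + d ^ 2) = (a * b + c * d) ^ 2 + 1 := by
    linear_combination (a * d - b * c + 1) * hdet
  have hs2 : (a * b + c * d) ^ 2 ≤ (a ^ 2 + c ^ 2) ^ 2 / 4 := by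
    have := sq_le_sq' (abs_le.1 hs).1 (abs_le.1 hs).2
    linarith
  generalize a ^ 2 + c ^ 2 = n at *
  generalize b ^ 2 + d ^ 2 = w at *
  generalize (a * b + c * d) ^ 2 = t at *
  have hn0 : 0 < n := by linarith
  have hδ' : 0 < 1 / δ := by positivity
  have hn : n ≤ 1.5 := by nlinarith
  refine ⟨by linarith, ?_⟩
  have h1 : w = (t + 1) / n := by rw [← hlag]; field_simp
  have h2 : (t + 1) / n ≤ n / 4 + 1 / n := by
    rw [div_le_iff₀ hn0, add_mul, div_mul_cancel₀ _ hn0.ne']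
    nlinarith
  have h3 : 1 / n ≤ 1 / δ := one_div_le_one_div_of_le hδ (hq.trans h₁)
  linarith

/-- **Mahler's compactness criterion** for unimodular lattices in the plane. -/
lemma exists_isCompact_forall_mul_mem {δ : ℝ} (hδ : 0 < δ) :
    ∃ D : Set SL(2, ℝ), IsCompact D ∧ ∀ g : SL(2, ℝ),
      (∀ v : Fin 2 → ℤ, v ≠ 0 → δ ≤ latticeVec g v 0 ^ 2 + latticeVec g v 1 ^ 2) →
      ∃ γ : SL(2, ℤ), g * (γ : SL(2, ℝ)) ∈ D := by
  refine ⟨_, isCompact_entries_le (2 + 1 / δ), fun g hg => ?_⟩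
  let N : SL(2, ℤ) → ℝ := fun γ =>
    (g * (γ : SL(2, ℝ))) 0 0 ^ 2 + (g * (γ : SL(2, ℝ))) 1 0 ^ 2
  have hN : ∀ γ, δ ≤ N γ := fun γ => by
    have := hg _ (mulVec_ne_zero γ (v := ![1, 0]) (by simp))
    rw [← latticeVec_mul] at this
    simpa [latticeVec_apply, N] using this
  have hbdd : BddBelow (Set.range N) := ⟨δ, by rintro _ ⟨γ, rfl⟩; exact hN γ⟩
  have hq : δ ≤ sInf (Set.range N) := le_csInf (Set.range_nonempty _) (by
    rintro _ ⟨γ, rfl⟩; exact hN γ)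
  obtain ⟨_, ⟨γ, rfl⟩, hγ⟩ := exists_lt_of_csInf_lt (Set.range_nonempty N)
    (show sInf (Set.range N) < 1.1 * sInf (Set.range N) by linarith)
  have hqN : ∀ γ, sInf (Set.range N) ≤ N γ := fun γ => csInf_le hbdd ⟨_, rfl⟩
  have hγ' := hqN γ
  set A : SL(2, ℝ) := g * (γ : SL(2, ℝ)) with hA
  have hNγ : N γ = A 0 0 ^ 2 + A 1 0 ^ 2 := rfl
  have hdet := det_eq_one A
  set k : ℤ := -round ((A 0 0 * A 0 1 + A 1 0 * A 1 1) / N γ) with hk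
  let T : SL(2, ℤ) := ⟨!![1, k; 0, 1], by simp⟩
  let S : SL(2, ℤ) := ⟨!![0, -1; 1, 0], by simp⟩
  have hT0 : ∀ i, (g * ((γ * T : SL(2, ℤ)) : SL(2, ℝ))) i 0 = A i 0 := fun i => by
    rw [map_mul, ← mul_assoc, mul_entry, ← hA, map_entry, map_entry]
    simp [T]
  have hT1 : ∀ i, (g * ((γ * T : SL(2, ℤ)) : SL(2, ℝ))) i 1 = A i 1 + k * A i 0 := fun i => by
    rw [map_mul, ← mul_assoc, mul_entry, ← hA, map_entry, map_entry]
    simp [T]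
    ring
  have hS : N (γ * T * S) = (A 0 1 + k * A 0 0) ^ 2 + (A 1 1 + k * A 1 0) ^ 2 := by
    have : ∀ i, (g * ((γ * T * S : SL(2, ℤ)) : SL(2, ℝ))) i 0 = A i 1 + k * A i 0 := fun i => by
      rw [map_mul, ← mul_assoc, mul_entry, hT0, hT1, map_entry, map_entry]
      simp [S]
    simp only [N, this]
  have hpos : 0 < N γ := by linarith
  have hs : |A 0 0 * (A 0 1 + k * A 0 0) + A 1 0 * (A 1 1 + k * A 1 0)| ≤ N γ / 2 := by
    have hr := abs_sub_round ((A 0 0 * A 0 1 + A 1 0 * A 1 1) / N γ)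
    have : A 0 0 * (A 0 1 + k * A 0 0) + A 1 0 * (A 1 1 + k * A 1 0)
        = ((A 0 0 * A 0 1 + A 1 0 * A 1 1) / N γ
        - round ((A 0 0 * A 0 1 + A 1 0 * A 1 1) / N γ)) * N γ := by
      rw [sub_mul, div_mul_cancel₀ _ hpos.ne', hk]
      push_cast
      linear_combination (-round ((A 0 0 * A 0 1 + A 1 0 * A 1 1) / N γ) : ℝ) * hNγ.symm
    rw [this, abs_mul, abs_of_pos hpos]
    nlinarith
  obtain ⟨hb0, hb1⟩ := reduced_basis_bound hδ hq (hNγ ▸ hγ') (hNγ ▸ hγ) (hS ▸ hqN _)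
    (by linear_combination hdet) (hNγ ▸ hs)
  have hδ' : 0 < 1 / δ := by positivity
  have key : ∀ x y : ℝ, x ^ 2 + y ^ 2 ≤ 2 + 1 / δ → |x| ≤ 2 + 1 / δ ∧ |y| ≤ 2 + 1 / δ :=
    fun x y h => ⟨abs_le_of_sq_le_sq (by nlinarith [sq_nonneg y]) (by linarith),
      abs_le_of_sq_le_sq (by nlinarith [sq_nonneg x]) (by linarith)⟩
  refine ⟨γ * T, Fin.forall_fin_two.2 ⟨Fin.forall_fin_two.2 ?_, Fin.forall_fin_two.2 ?_⟩⟩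
  · rw [hT0, hT1]
    exact ⟨(key _ _ hb0).1, (key _ _ hb1).1⟩
  · rw [hT0, hT1]
    exact ⟨(key _ _ hb0).2, (key _ _ hb1).2⟩

lemma exists_isCompact_of_avoids {ε : ℝ} (hε : 0 < ε) :
    ∃ D : Set SL(2, ℝ), IsCompact D ∧ ∀ g : SL(2, ℝ), Avoids ε g →
      ∃ γ : SL(2, ℤ), g * (γ : SL(2, ℝ)) ∈ D := by
  obtain ⟨D, hD, h⟩ := exists_isCompact_forall_mul_mem hε
  refine ⟨D, hD, fun g hg => h g fun v hv => (hg v hv).trans ?_⟩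
  rw [abs_le]
  constructor <;> nlinarith [sq_nonneg (latticeVec g v 0 - latticeVec g v 1),
    sq_nonneg (latticeVec g v 0 + latticeVec g v 1), sq_nonneg (latticeVec g v 0),
    sq_nonneg (latticeVec g v 1)]

/-- A lattice avoiding a star body `|x y| < ε` has no nonzero period under the unipotent flow. -/
lemma Avoids.eq_zero_of_lower_mul_eq {ε : ℝ} (hε : 0 < ε) {g : SL(2, ℝ)} (hg : Avoids ε g)
    {s : ℝ} {γ : SL(2, ℤ)} (h : lower s * g = g * (γ : SL(2, ℝ))) : s = 0 := by
  by_contra hs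
  have hg0 := hg.entry_ne_zero hε
  have e : ∀ i, latticeVec g (γ.1 *ᵥ ![1, 0] - ![1, 0]) i
      = latticeVec (lower s * g) ![1, 0] i - latticeVec g ![1, 0] i := fun i => by
    rw [h, latticeVec_mul]
    simp only [latticeVec_apply, Pi.sub_apply]
    push_cast
    ring
  have e0 := e 0
  have e1 := e 1
  rw [latticeVec_lower_zero, sub_self] at e0
  rw [latticeVec_lower_one, add_sub_cancel_left] at e1
  have hv : γ.1 *ᵥ ![1, 0] - ![1, 0] ≠ 0 := fun hv => by
    rw [hv] at e1
    simp [latticeVec_apply, hs, hg0] at e1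
  have := hg _ hv
  rw [e0, zero_mul, abs_zero] at this
  linarith

/-! ### Digit flips on the product of the space of digit sequences and the space of bases -/

/-- The change of `∑ 2 * 3 ^ k` over the digits `k` of `b` caused by flipping the digit `k`. -/
def flipShift (b : ℕ → Bool) (k : ℕ) : ℝ := (if b k then -1 else 1) * (2 * 3 ^ k)

/-- Flip the digit `k` and move the lattice accordingly. -/
def digitFlip (k : ℕ) (x : (ℕ → Bool) × SL(2, ℝ)) : (ℕ → Bool) × SL(2, ℝ) :=
  (Function.update x.1 k (!x.1 k), lower (flipShift x.1 k) * x.2)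

/-- Move the lattice by the unipotent flow. -/
def shear (τ : ℝ) (x : (ℕ → Bool) × SL(2, ℝ)) : (ℕ → Bool) × SL(2, ℝ) :=
  (x.1, lower τ * x.2)

/-- Change the basis of the lattice. -/
def changeBasis (γ : SL(2, ℤ)) (x : (ℕ → Bool) × SL(2, ℝ)) : (ℕ → Bool) × SL(2, ℝ) :=
  (x.1, x.2 * (γ : SL(2, ℝ)))

lemma abs_flipShift (b : ℕ → Bool) (k : ℕ) : |flipShift b k| = 2 * 3 ^ k := by
  unfold flipShift
  split_ifs <;> simp [abs_mul]

lemma continuous_digitFlip (k : ℕ) : Continuous (digitFlip k) := by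
  have hk : Continuous fun x : (ℕ → Bool) × SL(2, ℝ) => x.1 k :=
    (continuous_apply k).comp continuous_fst
  refine Continuous.prodMk (continuous_fst.update k
    ((continuous_of_discreteTopology (f := not)).comp hk)) ?_
  refine (continuous_lower.comp ?_).mul continuous_snd
  exact (continuous_of_discreteTopology (f := fun c : Bool =>
    (if c then (-1 : ℝ) else 1) * (2 * 3 ^ k))).comp hk

lemma continuous_shear (τ : ℝ) : Continuous (shear τ) :=
  continuous_fst.prodMk (continuous_const.mul continuous_snd)

lemma digitFlip_shear (k : ℕ) (τ : ℝ) (x : (ℕ → Bool) × SL(2, ℝ)) :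
    digitFlip k (shear τ x) = shear τ (digitFlip k x) := by
  simp only [digitFlip, shear, ← mul_assoc, ← lower_add, add_comm]

lemma digitFlip_changeBasis (k : ℕ) (γ : SL(2, ℤ)) (x : (ℕ → Bool) × SL(2, ℝ)) :
    digitFlip k (changeBasis γ x) = changeBasis γ (digitFlip k x) := by
  simp only [digitFlip, changeBasis, mul_assoc]

lemma shear_changeBasis (τ : ℝ) (γ : SL(2, ℤ)) (x : (ℕ → Bool) × SL(2, ℝ)) :
    shear τ (changeBasis γ x) = changeBasis γ (shear τ x) := by
  simp only [shear, changeBasis, mul_assoc]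

lemma shear_shear (σ τ : ℝ) (x : (ℕ → Bool) × SL(2, ℝ)) :
    shear σ (shear τ x) = shear (σ + τ) x := by
  simp only [shear, lower_add, mul_assoc]

lemma shear_zero (x : (ℕ → Bool) × SL(2, ℝ)) : shear 0 x = x := by
  simp [shear, lower_zero]

/-- Nonempty closed sets invariant under digit flips and changes of basis, all of whose lattices
avoid the star body `|x y| < ε`. -/
structure IsFlipInvariant (ε : ℝ) (K : Set ((ℕ → Bool) × SL(2, ℝ))) : Prop where
  isClosed : IsClosed K
  nonempty : K.Nonempty
  digitFlip_mem : ∀ k, ∀ x ∈ K, digitFlip k x ∈ K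
  changeBasis_mem : ∀ γ, ∀ x ∈ K, changeBasis γ x ∈ K
  avoids : ∀ x ∈ K, Avoids ε x.2

lemma IsFlipInvariant.exists_minimal {ε : ℝ} (hε : 0 < ε) {K : Set ((ℕ → Bool) × SL(2, ℝ))}
    (hK : IsFlipInvariant ε K) : ∃ M, Minimal (IsFlipInvariant ε) M := by
  obtain ⟨D, hD, hDγ⟩ := exists_isCompact_of_avoids hε
  obtain ⟨M, -, hM⟩ := zorn_superset_nonempty {K | IsFlipInvariant ε K} (fun c hc hchain hne => by
    refine ⟨⋂₀ c, ?_, fun s hs => Set.sInter_subset_of_mem hs⟩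
    obtain ⟨K₀, hK₀⟩ := hne
    refine ⟨isClosed_sInter fun K hK => (hc hK).isClosed, ?_,
      fun k x hx K hK => (hc hK).digitFlip_mem k x (hx K hK),
      fun γ x hx K hK => (hc hK).changeBasis_mem γ x (hx K hK),
      fun x hx => (hc hK₀).avoids x (hx K₀ hK₀)⟩
    have : Nonempty c := ⟨⟨K₀, hK₀⟩⟩
    have hclosed : IsClosed ((Set.univ : Set (ℕ → Bool)) ×ˢ closure D) :=
      isClosed_univ.prod isClosed_closure
    have := IsCompact.nonempty_iInter_of_directed_nonempty_isCompact_isClosed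
      (fun K : c => K.1 ∩ (Set.univ ×ˢ closure D)) (fun K L => by
        rcases hchain.total K.2 L.2 with h | h
        · exact ⟨K, subset_rfl, Set.inter_subset_inter_left _ h⟩
        · exact ⟨L, Set.inter_subset_inter_left _ h, subset_rfl⟩)
      (fun K => by
        obtain ⟨x, hx⟩ := (hc K.2).nonempty
        obtain ⟨γ, hγ⟩ := hDγ _ ((hc K.2).avoids x hx)
        exact ⟨changeBasis γ x, (hc K.2).changeBasis_mem γ x hx, trivial, subset_closure hγ⟩)
      (fun K => (isCompact_univ.prod hD.closure).inter_left (hc K.2).isClosed)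
      (fun K => (hc K.2).isClosed.inter hclosed)
    obtain ⟨x, hx⟩ := this
    exact ⟨x, fun K hK => (Set.mem_iInter.1 hx ⟨K, hK⟩).1⟩) K hK
  exact ⟨M, hM⟩

lemma shear_mem_of_minimal {ε : ℝ} {M : Set ((ℕ → Bool) × SL(2, ℝ))}
    (hM : Minimal (IsFlipInvariant ε) M) {τ : ℝ} {x : (ℕ → Bool) × SL(2, ℝ)} (hx : x ∈ M)
    (hτ : shear τ x ∈ M) : ∀ y ∈ M, shear τ y ∈ M := by
  have h : IsFlipInvariant ε (M ∩ shear τ ⁻¹' M) :=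
    { isClosed := hM.prop.isClosed.inter (hM.prop.isClosed.preimage (continuous_shear τ))
      nonempty := ⟨x, hx, hτ⟩
      digitFlip_mem := fun k y hy => ⟨hM.prop.digitFlip_mem k y hy.1, by
        rw [Set.mem_preimage, ← digitFlip_shear]
        exact hM.prop.digitFlip_mem k _ hy.2⟩
      changeBasis_mem := fun γ y hy => ⟨hM.prop.changeBasis_mem γ y hy.1, by
        rw [Set.mem_preimage, shear_changeBasis]
        exact hM.prop.changeBasis_mem γ _ hy.2⟩
      avoids := fun y hy => hM.prop.avoids y hy.1 }
  exact fun y hy => (hM.le_of_le h Set.inter_subset_left hy).2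

/-- The shears preserving a minimal set. -/
def shearStabilizer {ε : ℝ} {M : Set ((ℕ → Bool) × SL(2, ℝ))}
    (hM : Minimal (IsFlipInvariant ε) M) : AddSubgroup ℝ where
  carrier := {τ | ∀ y ∈ M, shear τ y ∈ M}
  zero_mem' := fun y hy => by rwa [shear_zero]
  add_mem' := fun {σ τ} hσ hτ y hy => by
    rw [← shear_shear]
    exact hσ _ (hτ y hy)
  neg_mem' := fun {τ} hτ => by
    obtain ⟨x, hx⟩ := hM.prop.nonempty
    refine shear_mem_of_minimal hM (hτ x hx) ?_
    rwa [shear_shear, neg_add_cancel, shear_zero]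

lemma exists_shear_gap {ε : ℝ} (hε : 0 < ε) {M : Set ((ℕ → Bool) × SL(2, ℝ))}
    (hM : Minimal (IsFlipInvariant ε) M) :
    ∃ κ > 0, ∀ τ x, x ∈ M → shear τ x ∈ M → τ = 0 ∨ κ ≤ |τ| := by
  obtain ⟨x₀, hx₀⟩ := hM.prop.nonempty
  set a := x₀.2 0 0
  set b := x₀.2 1 0
  have ha : a ≠ 0 := (hM.prop.avoids x₀ hx₀).entry_ne_zero hε
  refine ⟨ε / a ^ 2, by positivity, fun τ x hx hτ => ?_⟩
  by_contra! hcon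
  obtain ⟨hτ0, hτκ⟩ := hcon
  have hmem : τ ∈ shearStabilizer hM := shear_mem_of_minimal hM hx hτ
  set n : ℤ := round (-b / (a * τ))
  have hn : shear (n • τ) x₀ ∈ M := (shearStabilizer hM).zsmul_mem hmem n x₀ hx₀
  have hav := hM.prop.avoids _ hn ![1, 0] (by simp)
  rw [shear, latticeVec_lower_zero, latticeVec_lower_one] at hav
  simp only [latticeVec_apply, Matrix.cons_val_zero, Matrix.cons_val_one, Int.cast_one,
    Int.cast_zero, mul_one, mul_zero, add_zero, zsmul_eq_mul] at hav
  change ε ≤ |a * (b + n * τ * a)| at hav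
  have hr := abs_sub_round (-b / (a * τ))
  have heq : a * (b + n * τ * a) = -(a ^ 2 * (τ * (-b / (a * τ) - n))) := by
    field_simp
    ring
  rw [heq, abs_neg, abs_mul, abs_mul, abs_of_pos (by positivity : 0 < a ^ 2)] at hav
  rw [lt_div_iff₀ (by positivity)] at hτκ
  have h1 : |τ| * |-b / (a * τ) - n| ≤ |τ| * 1 := by
    gcongr
    linarith
  have h2 := mul_le_mul_of_nonneg_left h1 (sq_nonneg a)
  linarith

/-! ### Polynomial drift -/

lemma abs_le_of_two_scales {c α q m m' : ℝ} (hm : |m'| = 9 * |m|)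
    (h : |m * α - m ^ 2 * q| ≤ c) (h' : |m' * α - m' ^ 2 * q| ≤ c) :
    m ^ 2 * |q| ≤ c / 7 ∧ |m * α| ≤ 2 * c := by
  have hc : 0 ≤ c := (abs_nonneg _).trans h
  rw [← abs_of_nonneg (sq_nonneg m), ← abs_mul]
  have hm' : m' = 9 * m ∨ m' = -(9 * m) := by
    rw [← abs_eq_abs, abs_mul, hm]
    norm_num
  rw [abs_le] at h h'
  have h1 : |m ^ 2 * q| ≤ c / 7 := by
    rw [abs_le]
    rcases hm' with rfl | rfl <;> constructor <;> nlinarith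
  refine ⟨h1, ?_⟩
  rw [abs_le] at h1 ⊢
  constructor <;> linarith

lemma exists_escape {c α q : ℝ} (hc : 0 < c) {m : ℕ → ℝ} (hm : ∀ i, |m (i + 1)| = 9 * |m i|)
    (hm0 : 1 ≤ |m 0|) (hne : α ≠ 0 ∨ q ≠ 0) (h0 : |m 0 * α - m 0 ^ 2 * q| ≤ c)
    (h1 : |m 1 * α - m 1 ^ 2 * q| ≤ c) :
    ∃ i, c < |m i * α - m i ^ 2 * q| ∧ |m i * α - m i ^ 2 * q| ≤ 1100 * c ∧
      m i ^ 2 * |q| ≤ 1000 * c := by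
  classical
  have hlarge : ∀ i, (9 : ℝ) ^ i ≤ |m i| := fun i => by
    induction i with
    | zero => simpa using hm0
    | succ i ih => rw [hm, pow_succ]; linarith
  have hex : ∃ i, c < |m i * α - m i ^ 2 * q| := by
    by_contra! hcon
    have hb := fun i => abs_le_of_two_scales (hm i) (hcon i) (hcon (i + 1))
    have hunb : ∀ x : ℝ, (∀ i, |m i| * |x| ≤ 2 * c) → x = 0 := fun x hx => by
      by_contra hx0
      obtain ⟨i, hi⟩ := pow_unbounded_of_one_lt (2 * c / |x|) (by norm_num : (1 : ℝ) < 9)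
      rw [div_lt_iff₀ (abs_pos.2 hx0)] at hi
      have := hx i
      have := mul_le_mul_of_nonneg_right (hlarge i) (abs_nonneg x)
      linarith
    have hα : α = 0 := hunb α fun i => by rw [← abs_mul]; exact (hb i).2
    have hq : q = 0 := hunb q fun i => by
      have h9 : (1 : ℝ) ≤ |m i| := (one_le_pow₀ (by norm_num)).trans (hlarge i)
      have : |m i| * |q| ≤ m i ^ 2 * |q| := by
        gcongr
        rw [← sq_abs]
        nlinarith
      linarith [(hb i).1]
    tauto
  have hspec := Nat.find_spec hex
  have hmin := fun j (hj : j < Nat.find hex) => not_lt.1 (Nat.find_min hex hj)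
  obtain ⟨i, hi⟩ : ∃ i, Nat.find hex = i + 2 := by
    match hn : Nat.find hex with
    | 0 => rw [hn] at hspec; linarith
    | 1 => rw [hn] at hspec; linarith
    | i + 2 => exact ⟨i, rfl⟩
  rw [hi] at hspec
  have hb := abs_le_of_two_scales (hm i) (hmin i (by omega)) (hmin (i + 1) (by omega))
  have hm2 : |m (i + 2)| = 81 * |m i| := by rw [hm, hm]; ring
  have hq2 : m (i + 2) ^ 2 * |q| = 6561 * (m i ^ 2 * |q|) := by
    rw [← sq_abs, hm2, ← sq_abs (m i)]
    ring
  have hα2 : |m (i + 2) * α| = 81 * |m i * α| := by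
    rw [abs_mul, abs_mul, hm2]
    ring
  refine ⟨i + 2, hspec, ?_, ?_⟩
  · calc |m (i + 2) * α - m (i + 2) ^ 2 * q|
        ≤ |m (i + 2) * α| + |m (i + 2) ^ 2 * q| := abs_sub _ _
      _ = 81 * |m i * α| + 6561 * (m i ^ 2 * |q|) := by
        rw [hα2, abs_mul (m (i + 2) ^ 2), abs_of_nonneg (sq_nonneg (m (i + 2))), hq2]
      _ ≤ _ := by linarith
  · linarith

lemma tendsto_iff_entries {l : Filter ℕ} {f : ℕ → SL(2, ℝ)} {g : SL(2, ℝ)} :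
    Tendsto f l (𝓝 g) ↔ ∀ i j, Tendsto (fun n => f n i j) l (𝓝 (g i j)) :=
  (Matrix.SpecialLinearGroup.isClosedEmbedding_val.isEmbedding.tendsto_nhds_iff).trans
    (tendsto_pi_nhds.trans (forall_congr' fun _ => tendsto_pi_nhds))

lemma lower_conj_entries (m : ℝ) (h : SL(2, ℝ)) :
    (lower m * h * lower (-m)) 0 0 = h 0 0 - m * h 0 1 ∧
    (lower m * h * lower (-m)) 0 1 = h 0 1 ∧
    (lower m * h * lower (-m)) 1 0 = h 1 0 + (m * (h 0 0 - h 1 1) - m ^ 2 * h 0 1) ∧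
    (lower m * h * lower (-m)) 1 1 = m * h 0 1 + h 1 1 := by
  simp only [mul_entry]
  refine ⟨?_, ?_, ?_, ?_⟩ <;> simp [lower] <;> ring

/-- If pairs of lattices of a minimal set come arbitrarily close to each other over digit sequences
that become indistinguishable, then some pair differs by an element `± lower t`. -/
lemma exists_displacement_unipotent {ε : ℝ} (hε : 0 < ε) {M : Set ((ℕ → Bool) × SL(2, ℝ))}
    (hM : Minimal (IsFlipInvariant ε) M) {b b' : ℕ → ℕ → Bool} {g h : ℕ → SL(2, ℝ)}
    (hg : ∀ j, (b j, g j) ∈ M) (hh : ∀ j, (b' j, h j * g j) ∈ M)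
    (hodd : ∀ j i, b j (2 * i + 1) = b' j (2 * i + 1))
    (hlim : ∀ i, ∀ᶠ j in atTop, b j i = b' j i) (h1 : Tendsto h atTop (𝓝 1)) :
    ∃ j, h j 0 1 = 0 ∧ h j 0 0 = h j 1 1 := by
  by_contra! hcon
  obtain ⟨κ, hκ, hgap⟩ := exists_shear_gap hε hM
  obtain ⟨D, hD, hDγ⟩ := exists_isCompact_of_avoids hε
  set c := κ / 2000 with hc
  have hc0 : 0 < c := by positivity
  have hent := tendsto_iff_entries.1 h1
  have hq : Tendsto (fun j => h j 0 1) atTop (𝓝 0) := by simpa using hent 0 1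
  have hα : Tendsto (fun j => h j 0 0 - h j 1 1) atTop (𝓝 0) := by
    simpa using (hent 0 0).sub (hent 1 1)
  let m : ℕ → ℕ → ℝ := fun j i => flipShift (b j) (2 * i + 1)
  have hmabs : ∀ j i, |m j i| = 2 * 3 ^ (2 * i + 1) := fun j i => abs_flipShift _ _
  have hsmall : ∀ i, ∀ᶠ j in atTop,
      |m j i * (h j 0 0 - h j 1 1) - m j i ^ 2 * h j 0 1| ≤ c := fun i => by
    have ht : Tendsto (fun j => 2 * 3 ^ (2 * i + 1) * |h j 0 0 - h j 1 1|
        + (2 * 3 ^ (2 * i + 1)) ^ 2 * |h j 0 1|) atTop (𝓝 0) := by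
      simpa using (hα.abs.const_mul (2 * 3 ^ (2 * i + 1))).add
        (hq.abs.const_mul ((2 * 3 ^ (2 * i + 1)) ^ 2))
    filter_upwards [ht.eventually_le_const hc0] with j hj
    refine (abs_sub _ _).trans ?_
    rwa [abs_mul, abs_mul, abs_pow, hmabs]
  obtain ⟨J, hJ⟩ := eventually_atTop.1 ((hsmall 0).and (hsmall 1))
  have hesc : ∀ j, ∃ i, c < |m (j + J) i * (h (j + J) 0 0 - h (j + J) 1 1)
        - m (j + J) i ^ 2 * h (j + J) 0 1| ∧
      |m (j + J) i * (h (j + J) 0 0 - h (j + J) 1 1)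
        - m (j + J) i ^ 2 * h (j + J) 0 1| ≤ 1100 * c ∧
      m (j + J) i ^ 2 * |h (j + J) 0 1| ≤ 1000 * c := fun j => by
    refine exists_escape hc0 (fun i => ?_) ?_ ?_ (hJ _ (by omega)).1 (hJ _ (by omega)).2
    · rw [hmabs, hmabs]; ring
    · rw [hmabs]; norm_num
    · by_contra! hz
      exact hcon (j + J) hz.2 (sub_eq_zero.1 hz.1)
  choose i hi_low hi_up hi_sq using hesc
  let X : ℕ → (ℕ → Bool) × SL(2, ℝ) := fun j =>
    digitFlip (2 * i j + 1) (b (j + J), g (j + J))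
  let X' : ℕ → (ℕ → Bool) × SL(2, ℝ) := fun j =>
    digitFlip (2 * i j + 1) (b' (j + J), h (j + J) * g (j + J))
  have hX : ∀ j, X j ∈ M := fun j => hM.prop.digitFlip_mem _ _ (hg _)
  have hX' : ∀ j, X' j ∈ M := fun j => hM.prop.digitFlip_mem _ _ (hh _)
  choose γ hγ using fun j => hDγ _ (hM.prop.avoids _ (hX j))
  let μ : ℕ → ℝ := fun j => m (j + J) (i j)
  let τ : ℕ → ℝ := fun j => μ j * (h (j + J) 0 0 - h (j + J) 1 1) - μ j ^ 2 * h (j + J) 0 1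
  let H : ℕ → SL(2, ℝ) := fun j => lower (μ j) * h (j + J) * lower (-μ j)
  have hX'_eq : ∀ j, (X' j).2 = H j * (X j).2 := fun j => by
    have hm' : flipShift (b' (j + J)) (2 * i j + 1) = μ j := by
      simp only [μ, m, flipShift, hodd]
    have : lower (-μ j) * lower (μ j) = 1 := by rw [← lower_add, neg_add_cancel, lower_zero]
    change lower (flipShift (b' (j + J)) (2 * i j + 1)) * (h (j + J) * g (j + J)) =
      lower (μ j) * h (j + J) * lower (-μ j) * (lower (μ j) * g (j + J))
    rw [hm', mul_assoc (lower (μ j) * h (j + J)), ← mul_assoc (lower (-μ j)), this, one_mul,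
      mul_assoc]
  obtain ⟨⟨⟨β, G⟩, T⟩, ⟨-, hT⟩, φ, hφ, hlimφ⟩ :=
    ((isCompact_univ (X := ℕ → Bool)).prod hD).prod
      (isCompact_Icc (a := -(1100 * c)) (b := 1100 * c)) |>.tendsto_subseq
      (x := fun j => ((changeBasis (γ j) (X j)), τ j))
      (fun j => ⟨⟨trivial, hγ j⟩, abs_le.1 (hi_up j)⟩)
  have hXlim : Tendsto (fun j => changeBasis (γ (φ j)) (X (φ j))) atTop (𝓝 (β, G)) :=
    (continuous_fst.tendsto _).comp hlimφ
  have hTlim : Tendsto (fun j => τ (φ j)) atTop (𝓝 T) := (continuous_snd.tendsto _).comp hlimφ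
  have hφJ : Tendsto (fun j => φ j + J) atTop atTop :=
    (tendsto_add_atTop_nat J).comp hφ.tendsto_atTop
  have hμq : Tendsto (fun j => μ (φ j) * h (φ j + J) 0 1) atTop (𝓝 0) := by
    have hs : Tendsto (fun j => √(1000 * c * |h (φ j + J) 0 1|)) atTop (𝓝 0) := by
      simpa using ((hq.comp hφJ).abs.const_mul (1000 * c)).sqrt
    refine squeeze_zero_norm (fun j => ?_) hs
    rw [Real.norm_eq_abs]
    refine Real.abs_le_sqrt ?_
    rw [mul_pow, ← sq_abs (h (φ j + J) 0 1), sq |h (φ j + J) 0 1|, ← mul_assoc]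
    exact mul_le_mul_of_nonneg_right (hi_sq (φ j)) (abs_nonneg _)
  have hHlim : Tendsto (fun j => H (φ j)) atTop (𝓝 (lower T)) := by
    have hent' := fun i k => (hent i k).comp hφJ
    have hconj := fun j => lower_conj_entries (μ (φ j)) (h (φ j + J))
    refine tendsto_iff_entries.2 (Fin.forall_fin_two.2 ⟨Fin.forall_fin_two.2 ⟨?_, ?_⟩,
      Fin.forall_fin_two.2 ⟨?_, ?_⟩⟩)
    · simp only [H, (hconj _).1]
      simpa [lower] using (hent' 0 0).sub hμq
    · simp only [H, (hconj _).2.1]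
      simpa [lower, Function.comp_def] using hent' 0 1
    · simp only [H, (hconj _).2.2.1]
      simpa [lower] using (hent' 1 0).add hTlim
    · simp only [H, (hconj _).2.2.2]
      simpa [lower] using hμq.add (hent' 1 1)
  have hX'lim : Tendsto (fun j => changeBasis (γ (φ j)) (X' (φ j))) atTop
      (𝓝 (shear T (β, G))) := by
    refine Tendsto.prodMk_nhds ?_ ?_
    · refine tendsto_pi_nhds.2 fun n => ?_
      refine (tendsto_pi_nhds.1 ((continuous_fst.tendsto _).comp hXlim) n).congr' ?_
      filter_upwards [hφJ.eventually (hlim n)] with j hj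
      change Function.update (b (φ j + J)) (2 * i (φ j) + 1) (!b (φ j + J) (2 * i (φ j) + 1)) n =
        Function.update (b' (φ j + J)) (2 * i (φ j) + 1) (!b' (φ j + J) (2 * i (φ j) + 1)) n
      rw [Function.update_apply, Function.update_apply, hj, hodd]
    · have := hHlim.mul ((continuous_snd.tendsto _).comp hXlim)
      refine this.congr fun j => ?_
      change H (φ j) * ((X (φ j)).2 * _) = (X' (φ j)).2 * _
      rw [hX'_eq, mul_assoc (H (φ j))]
  have hmem := hM.prop.isClosed.mem_of_tendsto hXlim
    (Eventually.of_forall fun j => hM.prop.changeBasis_mem _ _ (hX _))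
  have hmem' := hM.prop.isClosed.mem_of_tendsto hX'lim
    (Eventually.of_forall fun j => hM.prop.changeBasis_mem _ _ (hX' _))
  have hTlow : c ≤ |T| := ge_of_tendsto hTlim.abs (Eventually.of_forall fun j => (hi_low _).le)
  have hTup : |T| ≤ 1100 * c := abs_le.2 hT
  rcases hgap T _ hmem hmem' with h0 | hle
  · rw [h0, abs_zero] at hTlow
    linarith
  · linarith

/-! ### Nonexistence of minimal sets -/

lemma not_minimal {ε : ℝ} (hε : 0 < ε) {M : Set ((ℕ → Bool) × SL(2, ℝ))} :
    ¬ Minimal (IsFlipInvariant ε) M := by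
  intro hM
  obtain ⟨D, hD, hDγ⟩ := exists_isCompact_of_avoids hε
  obtain ⟨⟨b, g⟩, hbg⟩ := hM.prop.nonempty
  let x : ℕ → (ℕ → Bool) × SL(2, ℝ) := fun k => digitFlip (2 * k) (b, g)
  have hx : ∀ k, x k ∈ M := fun k => hM.prop.digitFlip_mem _ _ hbg
  choose γ hγ using fun k => hDγ _ (hM.prop.avoids _ (hx k))
  obtain ⟨y, -, φ, hφ, hy⟩ := hD.tendsto_subseq hγ
  let Y : ℕ → SL(2, ℝ) := fun k => (x (φ k)).2 * (γ (φ k) : SL(2, ℝ))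
  have hY : Tendsto Y atTop (𝓝 y) := hy
  let h : ℕ → SL(2, ℝ) := fun k => Y (k + 1) * (Y k)⁻¹
  have hh : Tendsto h atTop (𝓝 1) := by
    simpa using ((tendsto_add_atTop_iff_nat 1).2 hY).mul hY.inv
  have h00 : ∀ᶠ k in atTop, 0 < h k 0 0 := by
    have := tendsto_iff_entries.1 hh 0 0
    exact this.eventually_const_lt (by simp)
  have h10 : ∀ᶠ k in atTop, |h k 1 0| < 1 := by
    have := (tendsto_iff_entries.1 hh 1 0).abs
    exact this.eventually_lt_const (by simp)
  obtain ⟨J, hJ⟩ := eventually_atTop.1 (h00.and h10)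
  have hYM : ∀ k, ((x (φ k)).1, Y k) ∈ M := fun k => hM.prop.changeBasis_mem _ _ (hx _)
  have hdigit : ∀ k i, i ≠ 2 * φ k → (x (φ k)).1 i = b i := fun k i hi => by
    simp only [x, digitFlip]
    exact Function.update_of_ne hi _ _
  have hle : ∀ k, k ≤ φ k := fun _ => hφ.le_apply
  obtain ⟨j, hj01, hjdiag⟩ := exists_displacement_unipotent hε hM
    (b := fun j => (x (φ (j + J))).1) (b' := fun j => (x (φ (j + J + 1))).1)
    (g := fun j => Y (j + J)) (h := fun j => h (j + J))
    (fun j => hYM _) (fun j => by simpa [h] using hYM (j + J + 1))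
    (fun j i => by rw [hdigit _ _ (by omega), hdigit _ _ (by omega)])
    (fun i => by
      filter_upwards [eventually_gt_atTop i] with j hj
      have h1 := hle (j + J)
      have h2 := hle (j + J + 1)
      rw [hdigit _ _ (by omega), hdigit _ _ (by omega)])
    ((tendsto_add_atTop_iff_nat J).2 hh)
  set k := j + J
  obtain ⟨hk00, hk10⟩ := hJ k (by omega)
  have hdet := det_eq_one (h k)
  rw [hj01, ← hjdiag, zero_mul, sub_zero] at hdet
  have hone : h k 0 0 = 1 := by nlinarith
  have hlow : h k = lower (h k 1 0) := by
    ext i l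
    fin_cases i <;> fin_cases l <;> simp [lower, hone, hj01, ← hjdiag]
  set t := h k 1 0
  set m := flipShift b (2 * φ k) with hm
  set m' := flipShift b (2 * φ (k + 1)) with hm'
  have hYk : lower t * (lower m * g * (γ (φ k) : SL(2, ℝ)))
      = lower m' * g * (γ (φ (k + 1)) : SL(2, ℝ)) := by
    have : h k * Y k = Y (k + 1) := by simp [h]
    rwa [hlow] at this
  have hrel : lower (-m' + (t + m)) * g
      = g * ((γ (φ (k + 1)) * (γ (φ k))⁻¹ : SL(2, ℤ)) : SL(2, ℝ)) := by
    rw [map_mul, map_inv, lower_add, lower_add, ← mul_assoc g, eq_mul_inv_iff_mul_eq]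
    have e : lower (-m') * lower m' = 1 := by rw [← lower_add, neg_add_cancel, lower_zero]
    calc lower (-m') * (lower t * lower m) * g * (γ (φ k) : SL(2, ℝ))
        = lower (-m') * (lower t * (lower m * g * (γ (φ k) : SL(2, ℝ)))) := by
          simp only [mul_assoc]
      _ = lower (-m') * lower m' * (g * (γ (φ (k + 1)) : SL(2, ℝ))) := by
          rw [hYk]; simp only [mul_assoc]
      _ = _ := by rw [e, one_mul]
  have hz := (hM.prop.avoids _ hbg).eq_zero_of_lower_mul_eq hε hrel
  have habs : |m| = 2 * 3 ^ (2 * φ k) := abs_flipShift _ _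
  have habs' : |m'| = 2 * 3 ^ (2 * φ (k + 1)) := abs_flipShift _ _
  have hlt : φ k < φ (k + 1) := hφ (Nat.lt_succ_self k)
  have hpow : (3 : ℝ) ^ (2 * φ k + 2) ≤ 3 ^ (2 * φ (k + 1)) :=
    pow_le_pow_right₀ (by norm_num) (by omega)
  have h1 : (1 : ℝ) ≤ 3 ^ (2 * φ k) := one_le_pow₀ (by norm_num)
  have hm't : m' = t + m := by linarith
  have := abs_add_le t m
  rw [← hm't, habs, habs'] at this
  rw [pow_add] at hpow
  linarith

lemma not_isFlipInvariant {ε : ℝ} (hε : 0 < ε) (K : Set ((ℕ → Bool) × SL(2, ℝ))) :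
    ¬ IsFlipInvariant ε K := fun hK =>
  let ⟨_, hM⟩ := hK.exists_minimal hε
  not_minimal hε hM

lemma continuous_foldr_digitFlip (l : List ℕ) :
    Continuous fun x : (ℕ → Bool) × SL(2, ℝ) => l.foldr digitFlip x := by
  induction l with
  | nil => exact continuous_id
  | cons k l ih => exact (continuous_digitFlip k).comp ih

lemma foldr_digitFlip_changeBasis (l : List ℕ) (γ : SL(2, ℤ)) (x : (ℕ → Bool) × SL(2, ℝ)) :
    l.foldr digitFlip (changeBasis γ x) = changeBasis γ (l.foldr digitFlip x) := by
  induction l with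
  | nil => rfl
  | cons k l ih => rw [List.foldr_cons, ih, digitFlip_changeBasis, List.foldr_cons]

lemma exists_foldr_digitFlip (l : List ℕ) (g : SL(2, ℝ)) :
    ∃ F : Finset ℕ, l.foldr digitFlip (fun _ => false, g)
      = (fun k => decide (k ∈ F), lower (∑ k ∈ F, 2 * 3 ^ k) * g) := by
  induction l with
  | nil => exact ⟨∅, by simp [lower_zero]⟩
  | cons k l ih =>
    obtain ⟨F, hF⟩ := ih
    rw [List.foldr_cons, hF]
    by_cases hk : k ∈ F
    · refine ⟨F.erase k, Prod.ext ?_ ?_⟩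
      · ext i
        by_cases hi : i = k <;> simp [digitFlip, hi, hk]
      · simp only [digitFlip, flipShift, hk, decide_true, if_true]
        rw [← mul_assoc, ← lower_add, ← Finset.add_sum_erase _ _ hk]
        congr 2
        ring
    · refine ⟨insert k F, Prod.ext ?_ ?_⟩
      · ext i
        by_cases hi : i = k <;> simp [digitFlip, hi, hk]
      · simp only [digitFlip, flipShift, hk, decide_false, Bool.false_eq_true, if_false]
        rw [← mul_assoc, ← lower_add, Finset.sum_insert hk, one_mul]

/-- No lattice stays away from the axes along all sums of distinct `2 * 3 ^ k`. -/
theorem not_forall_avoids {ε : ℝ} (hε : 0 < ε) (g : SL(2, ℝ)) :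
    ¬ ∀ F : Finset ℕ, Avoids ε (lower (∑ k ∈ F, 2 * 3 ^ k) * g) := by
  intro hg
  refine not_isFlipInvariant hε {x | ∀ l : List ℕ, Avoids ε (l.foldr digitFlip x).2}
    { isClosed := ?_
      nonempty := ⟨(fun _ => false, g), fun l => ?_⟩
      digitFlip_mem := fun k x hx l => ?_
      changeBasis_mem := fun γ x hx l => ?_
      avoids := fun x hx => hx [] }
  · rw [Set.ofPred_forall]
    exact isClosed_iInter fun l => (isClosed_setOf_avoids ε).preimage
      (continuous_snd.comp (continuous_foldr_digitFlip l))
  · obtain ⟨F, hF⟩ := exists_foldr_digitFlip l g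
    rw [hF]
    exact hg F
  · simpa using hx (l ++ [k])
  · rw [foldr_digitFlip_changeBasis]
    exact (hx l).mul_right γ

/-- A finitary form of `not_forall_avoids`. -/
lemma not_forall_exists_approx {ε : ℝ} (hε : 0 < ε) :
    ¬ ∀ n : ℕ, ∃ g : SL(2, ℝ), ∀ F ⊆ Finset.range n, ∃ y : ℝ, 0 ≤ y ∧ y ≤ (1 / 3) ^ n ∧
      ∀ v : Fin 2 → ℤ, v ≠ 0 →
        ε ≤ |latticeVec (lower (∑ k ∈ F, 2 * 3 ^ k + y) * g) v 0
          * latticeVec (lower (∑ k ∈ F, 2 * 3 ^ k + y) * g) v 1| ∨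
        3 ^ n ≤ latticeVec (lower (∑ k ∈ F, 2 * 3 ^ k + y) * g) v 1 ^ 2 := by
  intro H
  choose g hg using H
  have H' : ∀ (F : Finset ℕ) (n : ℕ), ∃ y : ℝ, 0 ≤ y ∧ y ≤ (1 / 3) ^ n ∧ (F ⊆ Finset.range n →
      ∀ v : Fin 2 → ℤ, v ≠ 0 →
        ε ≤ |latticeVec (lower (∑ k ∈ F, 2 * 3 ^ k + y) * g n) v 0
          * latticeVec (lower (∑ k ∈ F, 2 * 3 ^ k + y) * g n) v 1| ∨
        3 ^ n ≤ latticeVec (lower (∑ k ∈ F, 2 * 3 ^ k + y) * g n) v 1 ^ 2) := fun F n => by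
    by_cases hF : F ⊆ Finset.range n
    · obtain ⟨y, hy0, hy1, hy⟩ := hg n F hF
      exact ⟨y, hy0, hy1, fun _ => hy⟩
    · exact ⟨0, le_rfl, by positivity, fun h => absurd h hF⟩
  choose y hy0 hy1 hy using H'
  have hylim : ∀ F, Tendsto (y F) atTop (𝓝 0) := fun F =>
    squeeze_zero (hy0 F) (hy1 F) (tendsto_pow_atTop_nhds_zero_of_lt_one (by norm_num) (by norm_num))
  obtain ⟨D, hD, hDγ⟩ := exists_isCompact_forall_mul_mem (lt_min hε one_pos)
  have hshort : ∀ n, ∃ γ : SL(2, ℤ), lower (y ∅ n) * g n * (γ : SL(2, ℝ)) ∈ D := fun n => by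
    refine hDγ _ fun v hv => ?_
    have h := hy ∅ n (Finset.empty_subset _) v hv
    rw [Finset.sum_empty, zero_add] at h
    set a := latticeVec (lower (y ∅ n) * g n) v 0
    set b := latticeVec (lower (y ∅ n) * g n) v 1
    rcases h with h | h
    · refine (min_le_left _ _).trans (h.trans (abs_le.2 ⟨?_, ?_⟩)) <;>
        nlinarith [sq_nonneg (a - b), sq_nonneg (a + b)]
    · have : (1 : ℝ) ≤ 3 ^ n := one_le_pow₀ (by norm_num)
      exact (min_le_right _ _).trans (by nlinarith)
  choose γ hγ using hshort
  obtain ⟨L, -, φ, hφ, hL⟩ := hD.tendsto_subseq hγ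
  have hφ' := hφ.tendsto_atTop
  have hlow : ∀ (c : ℝ) {t : ℕ → ℝ}, Tendsto t atTop (𝓝 0) →
      Tendsto (fun n => lower (c + t n)) atTop (𝓝 (lower c)) := fun c t ht => by
    have := (continuous_lower.tendsto _).comp (ht.const_add c)
    rwa [add_zero] at this
  have hgL : Tendsto (fun n => g (φ n) * (γ (φ n) : SL(2, ℝ))) atTop (𝓝 L) := by
    have ht : Tendsto (fun n => -y ∅ (φ n)) atTop (𝓝 0) := by
      simpa using ((hylim ∅).comp hφ').neg
    have := (hlow 0 ht).mul hL
    rw [lower_zero, one_mul] at this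
    refine this.congr fun n => ?_
    rw [Function.comp_apply, mul_assoc (lower _), ← mul_assoc, ← lower_add, zero_add,
      neg_add_cancel, lower_zero, one_mul]
  refine not_forall_avoids hε L fun F v hv => ?_
  set s : ℝ := ∑ k ∈ F, 2 * 3 ^ k
  have hW : Tendsto (fun n => lower (s + y F (φ n)) * (g (φ n) * (γ (φ n) : SL(2, ℝ)))) atTop
      (𝓝 (lower s * L)) := (hlow s ((hylim F).comp hφ')).mul hgL
  have hcoord := fun i => ((continuous_latticeVec v i).tendsto _).comp hW
  have hsub : ∀ᶠ n in atTop, F ⊆ Finset.range (φ n) := by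
    obtain ⟨N, hN⟩ := F.exists_nat_subset_range
    filter_upwards [hφ'.eventually_ge_atTop N] with n hn
    exact hN.trans (Finset.range_mono hn)
  have hpow : Tendsto (fun n => (3 : ℝ) ^ φ n) atTop atTop :=
    (tendsto_pow_atTop_atTop_of_one_lt (by norm_num)).comp hφ'
  refine ge_of_tendsto ((hcoord 0).mul (hcoord 1)).abs ?_
  filter_upwards [hsub, ((hcoord 1).pow 2).eventually_le_const (lt_add_one _),
    hpow.eventually_gt_atTop (latticeVec (lower s * L) v 1 ^ 2 + 1)] with n hn hb hp
  simp only [Function.comp_apply, ← mul_assoc, latticeVec_mul] at hb ⊢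
  rcases hy F (φ n) hn _ (mulVec_ne_zero (γ (φ n)) hv) with h | h
  · exact h
  · linarith

/-! ### Badly approximable points and the Cantor set -/

/-- The reals `x` with `k * |k * x - m| ≥ ε` for all integers `m` and `k > 0`. -/
def badSet (ε : ℝ) : Set ℝ :=
  {x | ∀ (m : ℤ) (k : ℕ), 0 < k → ε / k ≤ |(k : ℝ) * x - m|}

lemma le_abs_mul_of_mem_badSet {ε x : ℝ} (hx : x ∈ badSet ε) {k : ℤ} (hk : k ≠ 0) (j : ℤ) :
    ε ≤ |(k : ℝ) * (k * x + j)| := by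
  have hpos : 0 < k.natAbs := Int.natAbs_pos.2 hk
  have hpos' : (0 : ℝ) < k.natAbs := by exact_mod_cast hpos
  rw [abs_mul, ← Int.cast_abs, Int.abs_eq_natAbs, Int.cast_natCast, mul_comm, ← div_le_iff₀ hpos']
  rcases Int.natAbs_eq k with h | h
  · have h' : (k : ℝ) = (k.natAbs : ℝ) := congrArg (Int.cast (R := ℝ)) h
    refine (hx (-j) _ hpos).trans_eq ?_
    rw [h', Int.cast_neg, sub_neg_eq_add]
  · have h' : (k : ℝ) = -(k.natAbs : ℝ) := by exact_mod_cast congrArg (Int.cast (R := ℝ)) h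
    refine (hx j _ hpos).trans_eq ?_
    rw [h', ← abs_neg]
    congr 1
    ring

lemma sum_map_add_right (F : Finset ℕ) (m : ℕ) :
    ∑ k ∈ F.map (addRightEmbedding m), 2 * 3 ^ k = 3 ^ m * ∑ k ∈ F, 2 * 3 ^ k := by
  rw [Finset.sum_map, Finset.mul_sum]
  refine Finset.sum_congr rfl fun k _ => ?_
  rw [addRightEmbedding_apply, pow_add]
  ring

/-- It is impossible that for every depth there is a triadic interval all of whose Cantor
subintervals of that relative depth meet the bad set. -/
lemma not_forall_exists_meets_badSet {ε : ℝ} (hε : 0 < ε) :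
    ¬ ∀ n : ℕ, 0 < n → ∃ N p : ℕ, ∀ F ⊆ Finset.range n, ∃ x ∈ badSet ε,
      ((3 ^ n * p + ∑ k ∈ F, 2 * 3 ^ k : ℕ) : ℝ) ≤ 3 ^ (N + n) * x ∧
      3 ^ (N + n) * x ≤ ((3 ^ n * p + ∑ k ∈ F, 2 * 3 ^ k : ℕ) : ℝ) + 1 := by
  intro H
  refine not_forall_exists_approx hε fun n => ?_
  obtain ⟨N, p, hp⟩ := H (2 * n + 1) (by omega)
  set r : ℝ := √(3 ^ (N + n)) with hr
  have hr0 : 0 < r := Real.sqrt_pos.2 (by positivity)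
  have hr2 : r ^ 2 = 3 ^ (N + n) := Real.sq_sqrt (by positivity)
  have hdet : (!![1 / r, 0; 3 ^ n * p / r, r] : Matrix (Fin 2) (Fin 2) ℝ).det = 1 := by
    rw [Matrix.det_fin_two_of, zero_mul, sub_zero, one_div_mul_cancel hr0.ne']
  obtain ⟨g, h00, h01, h10, h11⟩ : ∃ g : SL(2, ℝ),
      g 0 0 = 1 / r ∧ g 0 1 = 0 ∧ g 1 0 = 3 ^ n * p / r ∧ g 1 1 = r :=
    ⟨⟨_, hdet⟩, rfl, rfl, rfl, rfl⟩
  refine ⟨g, fun F hF => ?_⟩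
  obtain ⟨x, hx, hlo, hup⟩ := hp (F.map (addRightEmbedding (n + 1))) (fun i hi => by
    obtain ⟨k, hk, rfl⟩ := Finset.mem_map.1 hi
    have := Finset.mem_range.1 (hF hk)
    simp only [addRightEmbedding_apply, Finset.mem_range]
    omega)
  rw [sum_map_add_right] at hlo hup
  push_cast at hlo hup
  set s : ℝ := ∑ k ∈ F, 2 * 3 ^ k
  have e1 : (3 : ℝ) ^ (2 * n + 1) = 3 ^ (n + 1) * 3 ^ n := by ring
  have e2 : (3 : ℝ) ^ (N + (2 * n + 1)) = 3 ^ (n + 1) * 3 ^ (N + n) := by ring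
  rw [e1, e2, mul_assoc, mul_assoc, ← mul_add] at hlo hup
  have h3 : (0 : ℝ) < 3 ^ (n + 1) := by positivity
  have hxy : 3 ^ n * p + s + (3 ^ (N + n) * x - (3 ^ n * p + s)) = r ^ 2 * x := by rw [hr2]; ring
  refine ⟨3 ^ (N + n) * x - (3 ^ n * p + s), sub_nonneg.2 (le_of_mul_le_mul_left hlo h3), ?_,
    fun v hv => ?_⟩
  · rw [one_div, inv_pow, ← one_div, le_div_iff₀ (by positivity)]
    have : 0 ≤ 3 ^ (N + n) * x - (3 ^ n * p + s) := sub_nonneg.2 (le_of_mul_le_mul_left hlo h3)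
    rw [pow_succ] at hlo hup
    nlinarith [pow_pos (by norm_num : (0 : ℝ) < 3) n]
  · rw [latticeVec_lower_zero, latticeVec_lower_one]
    set y := 3 ^ (N + n) * x - (3 ^ n * p + s)
    simp only [latticeVec_apply, h00, h01, h10, h11, zero_mul, add_zero]
    have hb : 3 ^ n * p / r * v 0 + r * v 1 + (s + y) * (1 / r * v 0) = r * (v 0 * x + v 1) := by
      field_simp
      linear_combination (v 0 : ℝ) * hxy
    rw [hb]
    by_cases h0 : v 0 = 0
    · right
      have h1 : v 1 ≠ 0 := fun h1 => hv (by ext i; fin_cases i <;> assumption)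
      have h1' : (1 : ℝ) ≤ (v 1 : ℝ) ^ 2 := by
        exact_mod_cast Int.add_one_le_iff.2 (show (0 : ℤ) < v 1 ^ 2 by positivity)
      rw [mul_pow, hr2, h0, Int.cast_zero, zero_mul, zero_add]
      have : (3 : ℝ) ^ n ≤ 3 ^ (N + n) := pow_le_pow_right₀ (by norm_num) (by omega)
      nlinarith [pow_pos (by norm_num : (0 : ℝ) < 3) (N + n)]
    · left
      refine (le_abs_mul_of_mem_badSet hx h0 (v 1)).trans_eq ?_
      congr 1
      field_simp

/-- The integer with base-3 digits `a 0, …, a (i - 1)`, the first one leading. -/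
def prefixInt (a : ℕ → ℕ) : ℕ → ℕ
  | 0 => 0
  | i + 1 => 3 * prefixInt a i + a i

lemma exists_prefixInt_add {a : ℕ → ℕ} (ha : ∀ n, a n = 0 ∨ a n = 2) (N n : ℕ) :
    ∃ F ⊆ Finset.range n, prefixInt a (N + n) = 3 ^ n * prefixInt a N + ∑ k ∈ F, 2 * 3 ^ k := by
  induction n with
  | zero => exact ⟨∅, by simp⟩
  | succ n ih =>
    obtain ⟨F, hF, h⟩ := ih
    have hF' : F.map (addRightEmbedding 1) ⊆ Finset.range (n + 1) := fun i hi => by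
      obtain ⟨k, hk, rfl⟩ := Finset.mem_map.1 hi
      have := Finset.mem_range.1 (hF hk)
      simp only [addRightEmbedding_apply, Finset.mem_range]
      omega
    have hs := sum_map_add_right F 1
    rw [pow_one] at hs
    rw [← add_assoc, prefixInt, h]
    rcases ha (N + n) with h0 | h2
    · refine ⟨_, hF', ?_⟩
      rw [hs, h0]
      ring
    · refine ⟨insert 0 (F.map (addRightEmbedding 1)),
        Finset.insert_subset (by simp) hF', ?_⟩
      rw [Finset.sum_insert (by simp), hs, h2]
      ring

lemma prefixInt_bounds {a : ℕ → ℕ} (ha : ∀ n, a n = 0 ∨ a n = 2) (i : ℕ) :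
    (prefixInt a i : ℝ) ≤ 3 ^ i * ∑' n : ℕ, (a n : ℝ) / 3 ^ (n + 1) ∧
    3 ^ i * ∑' n : ℕ, (a n : ℝ) / 3 ^ (n + 1) ≤ prefixInt a i + 1 := by
  have hgeom : HasSum (fun n : ℕ => (2 : ℝ) / 3 ^ (n + 1)) 1 := by
    have := (hasSum_geometric_of_lt_one (by norm_num : (0 : ℝ) ≤ 1 / 3) (by norm_num)).mul_left
      (2 / 3)
    have heq : (fun n : ℕ => (2 : ℝ) / 3 ^ (n + 1)) = fun n => 2 / 3 * (1 / 3) ^ n := by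
      ext n
      rw [pow_succ, one_div, inv_pow]
      field_simp
    rwa [← heq, show (2 / 3 : ℝ) * (1 - 1 / 3)⁻¹ = 1 by norm_num] at this
  have hle : ∀ i n, (a (n + i) : ℝ) / 3 ^ (n + 1) ≤ 2 / 3 ^ (n + 1) := fun i n => by
    gcongr
    rcases ha (n + i) with h | h <;> norm_num [h]
  have hsum : ∀ i, Summable fun n => (a (n + i) : ℝ) / 3 ^ (n + 1) := fun i =>
    hgeom.summable.of_nonneg_of_le (fun n => by positivity) (hle i)
  have htail : 3 ^ i * ∑' n : ℕ, (a n : ℝ) / 3 ^ (n + 1)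
      = prefixInt a i + ∑' n : ℕ, (a (n + i) : ℝ) / 3 ^ (n + 1) := by
    induction i with
    | zero => simp [prefixInt]
    | succ i ih =>
      rw [pow_succ', mul_assoc, ih, (hsum i).tsum_eq_zero_add, mul_add, mul_add, ← tsum_mul_left]
      simp only [prefixInt]
      have : ∀ n : ℕ, 3 * ((a (n + 1 + i) : ℝ) / 3 ^ (n + 1 + 1))
          = (a (n + (i + 1)) : ℝ) / 3 ^ (n + 1) := fun n => by
        rw [pow_succ _ (n + 1), add_assoc n, add_comm 1]
        field_simp
      simp only [this]
      push_cast
      simp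
      ring
  have h0 : 0 ≤ ∑' n : ℕ, (a (n + i) : ℝ) / 3 ^ (n + 1) := tsum_nonneg fun n => by positivity
  have h1 : ∑' n : ℕ, (a (n + i) : ℝ) / 3 ^ (n + 1) ≤ 1 := by
    rw [← hgeom.tsum_eq]
    exact (hsum i).tsum_le_tsum (hle i) hgeom.summable
  rw [htail]
  constructor <;> linarith

/-! ### The covering argument -/

/-- The integers with `n` base-3 digits, all of them `0` or `2`. -/
def cantorInts (n : ℕ) : Finset ℕ :=
  (Finset.range n).powerset.image fun F => ∑ k ∈ F, 2 * 3 ^ k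

lemma card_cantorInts_le (n : ℕ) : (cantorInts n).card ≤ 2 ^ n :=
  Finset.card_image_le.trans (by simp)

/-- The words of length `j` over the alphabet `cantorInts n`, read in base `3 ^ n`, in which
the letter `d (n * i) q` never follows a prefix `q` of length `i`. -/
def restrictedWords (n : ℕ) (d : ℕ → ℕ → ℕ) : ℕ → Finset ℕ
  | 0 => {0}
  | j + 1 => (restrictedWords n d j).biUnion fun q =>
      ((cantorInts n).erase (d (n * j) q)).image (3 ^ n * q + ·)

lemma card_restrictedWords_le {n : ℕ} {d : ℕ → ℕ → ℕ} (hd : ∀ N p, d N p ∈ cantorInts n) (j : ℕ) :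
    (restrictedWords n d j).card ≤ (2 ^ n - 1) ^ j := by
  induction j with
  | zero => simp [restrictedWords]
  | succ j ih =>
    refine (Finset.card_biUnion_le_card_mul _ _ (2 ^ n - 1) fun q _ => ?_).trans ?_
    · refine Finset.card_image_le.trans ?_
      rw [Finset.card_erase_of_mem (hd _ _)]
      exact Nat.sub_le_sub_right (card_cantorInts_le n) 1
    · rw [pow_succ]
      exact Nat.mul_le_mul_right _ ih

/-- A subset of the Cantor set that misses at every scale one of the `2 ^ n` subintervals of
relative depth `n` is null for the Hausdorff measure of the dimension of the Cantor set. -/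
lemma hausdorffMeasure_eq_zero_of_misses {A : Set ℝ} {n : ℕ} (hn : 0 < n)
    (hA : ∀ N p : ℕ, ∃ F ⊆ Finset.range n, ∀ x ∈ A,
      ((3 ^ n * p + ∑ k ∈ F, 2 * 3 ^ k : ℕ) : ℝ) ≤ 3 ^ (N + n) * x →
      ((3 ^ n * p + ∑ k ∈ F, 2 * 3 ^ k : ℕ) : ℝ) + 1 < 3 ^ (N + n) * x) :
    Measure.hausdorffMeasure (Real.log 2 / Real.log 3) (A ∩ middleThirdCantorSet) = 0 := by
  have hA' : ∀ N p : ℕ, ∃ d ∈ cantorInts n, ∀ x ∈ A, ((3 ^ n * p + d : ℕ) : ℝ) ≤ 3 ^ (N + n) * x →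
      ((3 ^ n * p + d : ℕ) : ℝ) + 1 < 3 ^ (N + n) * x := fun N p => by
    obtain ⟨F, hF, h⟩ := hA N p
    exact ⟨_, Finset.mem_image_of_mem _ (Finset.mem_powerset.2 hF), h⟩
  choose d hd hmiss using hA'
  have hcover : ∀ j, A ∩ middleThirdCantorSet ⊆ ⋃ q : restrictedWords n d j,
      Set.Icc ((q : ℝ) / 3 ^ (n * j)) (((q : ℝ) + 1) / 3 ^ (n * j)) := by
    rintro j x ⟨hxA, -, a, ha, hxa⟩
    have hb := fun i => prefixInt_bounds ha i
    rw [← hxa] at hb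
    have hmem : ∀ j, prefixInt a (n * j) ∈ restrictedWords n d j := fun j => by
      induction j with
      | zero => simp [restrictedWords, prefixInt]
      | succ j ih =>
        obtain ⟨F, hF, h⟩ := exists_prefixInt_add ha (n * j) n
        refine Finset.mem_biUnion.2 ⟨_, ih, Finset.mem_image.2 ⟨∑ k ∈ F, 2 * 3 ^ k,
          Finset.mem_erase.2 ⟨fun heq => ?_,
            Finset.mem_image_of_mem _ (Finset.mem_powerset.2 hF)⟩, h.symm⟩⟩
        have hlt := hmiss (n * j) (prefixInt a (n * j)) x hxA
        rw [← heq, ← h] at hlt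
        exact absurd (hlt (hb _).1) (not_lt.2 (hb _).2)
    refine Set.mem_iUnion.2 ⟨⟨_, hmem j⟩, ?_, ?_⟩
    · rw [div_le_iff₀' (by positivity)]
      exact (hb _).1
    · rw [le_div_iff₀' (by positivity)]
      exact (hb _).2
  have hdiam : ∀ j (q : restrictedWords n d j), Metric.ediam
      (Set.Icc ((q : ℝ) / 3 ^ (n * j)) (((q : ℝ) + 1) / 3 ^ (n * j)))
      = ENNReal.ofReal ((1 / 3) ^ (n * j)) := fun j q => by
    rw [Real.ediam_Icc, ← sub_div, add_sub_cancel_left, _root_.one_div_pow]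
  have hpow : Tendsto (fun j => ENNReal.ofReal ((1 / 3) ^ (n * j))) atTop (𝓝 0) := by
    rw [← ENNReal.ofReal_zero]
    refine ENNReal.tendsto_ofReal ?_
    simp only [pow_mul]
    exact tendsto_pow_atTop_nhds_zero_of_lt_one (by positivity)
      (pow_lt_one₀ (by norm_num) (by norm_num) hn.ne')
  have hdim : ∀ j : ℕ, ENNReal.ofReal ((1 / 3) ^ (n * j)) ^ (Real.log 2 / Real.log 3)
      = ENNReal.ofReal ((1 / 2) ^ (n * j)) := fun j => by
    rw [ENNReal.ofReal_rpow_of_pos (by positivity), ← Real.rpow_natCast, ← Real.rpow_mul (by norm_num),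
      mul_comm, Real.rpow_mul (by norm_num), Real.rpow_natCast, one_div, Real.inv_rpow (by norm_num),
      ← Real.logb, Real.rpow_logb (by norm_num) (by norm_num) (by norm_num), one_div]
  have hle := Measure.hausdorffMeasure_le_liminf_sum (Real.log 2 / Real.log 3)
    (A ∩ middleThirdCantorSet) _ hpow _ (Eventually.of_forall fun j q => (hdiam j q).le)
    (Eventually.of_forall hcover)
  have hsum : ∀ j, ∑ q : restrictedWords n d j, Metric.ediam
      (Set.Icc ((q : ℝ) / 3 ^ (n * j)) (((q : ℝ) + 1) / 3 ^ (n * j))) ^ (Real.log 2 / Real.log 3)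
      ≤ ENNReal.ofReal (((2 ^ n - 1) * (1 / 2) ^ n) ^ j) := fun j => by
    simp only [hdiam, hdim, Finset.sum_const, Finset.card_univ, Fintype.card_coe, nsmul_eq_mul]
    rw [← ENNReal.ofReal_natCast, ← ENNReal.ofReal_mul (by positivity), mul_pow, pow_mul]
    refine ENNReal.ofReal_le_ofReal (mul_le_mul_of_nonneg_right ?_ (by positivity))
    have := card_restrictedWords_le hd j
    have h' : ((restrictedWords n d j).card : ℝ) ≤ ((2 ^ n - 1 : ℕ) : ℝ) ^ j := by
      exact_mod_cast this
    rwa [Nat.cast_sub Nat.one_le_two_pow, Nat.cast_pow, Nat.cast_one, Nat.cast_ofNat] at h'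
  have hzero : Tendsto (fun j => ENNReal.ofReal ((((2 : ℝ) ^ n - 1) * (1 / 2) ^ n) ^ j)) atTop
      (𝓝 0) := by
    rw [← ENNReal.ofReal_zero]
    have h1 : (1 : ℝ) ≤ 2 ^ n := one_le_pow₀ (by norm_num)
    have h2 : (2 : ℝ) ^ n * (1 / 2) ^ n = 1 := by rw [← mul_pow]; norm_num
    have h3 : (0 : ℝ) < (1 / 2) ^ n := by positivity
    exact ENNReal.tendsto_ofReal (tendsto_pow_atTop_nhds_zero_of_lt_one
      (mul_nonneg (by linarith) h3.le) (by linarith))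
  have := tendsto_of_tendsto_of_tendsto_of_le_of_le tendsto_const_nhds hzero
    (fun _ => zero_le) hsum
  rw [this.liminf_eq] at hle
  exact le_antisymm hle zero_le

lemma hausdorffMeasure_badSet_inter {ε : ℝ} (hε : 0 < ε) :
    Measure.hausdorffMeasure (Real.log 2 / Real.log 3) (badSet ε ∩ middleThirdCantorSet) = 0 := by
  have h := not_forall_exists_meets_badSet hε
  push Not at h
  obtain ⟨n, hn, h⟩ := h
  exact hausdorffMeasure_eq_zero_of_misses hn h

lemma isWA_iff (x : ℝ) : IsWA x ↔ ∀ j : ℕ, x ∉ badSet (1 / (j + 1)) := by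
  constructor
  · intro h j hx
    obtain ⟨m, k, hk, hlt⟩ := h (1 / (j + 1)) (by positivity)
    exact absurd (hx m k hk) (not_le.2 hlt)
  · intro h ε hε
    obtain ⟨j, hj⟩ := exists_nat_one_div_lt hε
    have hx := h j
    simp only [badSet, Set.mem_ofPred_eq] at hx
    push Not at hx
    obtain ⟨m, k, hk, hlt⟩ := hx
    exact ⟨m, k, hk, hlt.trans_le (by gcongr)⟩

lemma isClosed_badSet (ε : ℝ) : IsClosed (badSet ε) := by
  simp only [badSet, Set.ofPred_forall]
  exact isClosed_iInter fun m => isClosed_iInter fun k => isClosed_iInter fun _ =>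
    isClosed_le continuous_const (by fun_prop)

end CantorWellApproximable

/-- with respect to the Hausdorff measure of dimension `log 2/log 3`
restricted to the middle-third Cantor set, almost every point is well approximable. -/
theorem stmt4 :
    ∀ᵐ x ∂((MeasureTheory.Measure.hausdorffMeasure
        (Real.log 2 / Real.log 3) : Measure ℝ).restrict middleThirdCantorSet), IsWA x := by
  simp only [CantorWellApproximable.isWA_iff, ae_all_iff]
  intro j
  rw [ae_iff]
  simp only [not_not, Set.ofPred_mem_eq]
  rw [Measure.restrict_apply (CantorWellApproximable.isClosed_badSet _).measurableSet]
  exact CantorWellApproximable.hausdorffMeasure_badSet_inter (by positivity)
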